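/- arXiv:1503.00812 — 10 statements merged into one kernel-verified Lean document; each statement's English description precedes it below -/
import Mathlib

section
/- Let S ⊆ ℝᵐ be an open set containing the origin and let f : S → ℝᵐ be a continuously differentiable function with f(0) ≠ 0. Then there exists an open neighborhood U ⊆ S of the origin such that the set { s ∈ U : ⟪f(s), s⟫ ≠ 0 } is open in U and dense in U. -/
open scoped RealInnerProductSpace

/-- Lemma: if `f` is continuously differentiable on an open set `S ∋ 0` with `f 0 ≠ 0`,
then there is an open neighborhood `U ⊆ S` of the origin in which the set
`{s ∈ U : ⟪f s, s⟫ ≠ 0}` is open and dense in `U`. -/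
theorem stmt1 (m : ℕ) (S : Set (EuclideanSpace ℝ (Fin m))) (hS : IsOpen S)
    (h0 : (0 : EuclideanSpace ℝ (Fin m)) ∈ S)
    (f : EuclideanSpace ℝ (Fin m) → EuclideanSpace ℝ (Fin m))
    (hf : ContDiffOn ℝ 1 f S) (hf0 : f 0 ≠ 0) :
    ∃ U : Set (EuclideanSpace ℝ (Fin m)), U ⊆ S ∧ IsOpen U ∧
      (0 : EuclideanSpace ℝ (Fin m)) ∈ U ∧
      IsOpen {s | s ∈ U ∧ ⟪f s, s⟫ ≠ 0} ∧
      U ⊆ closure {s | s ∈ U ∧ ⟪f s, s⟫ ≠ 0} := by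
  have hdf : ContinuousOn (fderiv ℝ f) S := hf.continuousOn_fderiv_of_isOpen hS le_rfl
  have hfc : ContinuousOn f S := hf.continuousOn
  have hcont : ContinuousOn (fun s => ⟪f s, f 0⟫ + ⟪fderiv ℝ f s (f 0), s⟫) S :=
    (hfc.inner continuousOn_const).add
      ((hdf.clm_apply continuousOn_const).inner continuousOn_id)
  have hg : ContinuousOn (fun s => ⟪f s, s⟫) S := hfc.inner continuousOn_id
  have hU : IsOpen (S ∩ (fun s => ⟪f s, f 0⟫ + ⟪fderiv ℝ f s (f 0), s⟫) ⁻¹' {0}ᶜ) :=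
    hcont.isOpen_inter_preimage hS isOpen_compl_singleton
  refine ⟨_, Set.inter_subset_left, hU, ⟨h0, ?_⟩, ?_, ?_⟩
  · simpa using hf0
  · exact (hg.mono Set.inter_subset_left).isOpen_inter_preimage hU isOpen_compl_singleton
  · intro s hs
    by_contra hcl
    have hev : (fun x => ⟪f x, x⟫) =ᶠ[nhds s] fun _ => (0 : ℝ) := by
      filter_upwards [hU.mem_nhds hs, isClosed_closure.isOpen_compl.mem_nhds hcl] with x hxU hx
      by_contra hne
      exact hx (subset_closure ⟨hxU, hne⟩)
    have hfs : DifferentiableAt ℝ f s :=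
      (hf.differentiableOn one_ne_zero).differentiableAt (hS.mem_nhds hs.1)
    have hder := fderiv_inner_apply ℝ hfs differentiableAt_id (f 0)
    simp only [id] at hder
    rw [hev.fderiv_eq] at hder
    exact hs.2 (by simpa using hder.symm)
end

section
/- Let n ≥ 3 and let an oriented graph with m edges on vertex set Fin n be given by head and tail maps h, t : Fin m → Fin n with h k ≠ t k for all k, and suppose the associated simple graph G (where i and j are adjacent iff i ≠ j and some edge k has {h k, t k} = {i, j}) is connected. Let x : Fin n → (Fin 2 → ℝ) be a multi-point whose rigidity matrix R satisfies rank R = 2n − 3 (infinitesimal rigidity). Then there exist edges k, l ∈ Fin m and vertices v, p, q ∈ Fin n such that {h k, t k} = {v, p}, {h l, t l} = {v, q}, and (x p − x v) ∧ (x q − x v) ≠ 0; that is, at least two edges sharing the common vertex v have non-parallel edge vectors. -/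
/-- The wedge product of two vectors in `ℝ²`. -/
def wedge (u v : Fin 2 → ℝ) : ℝ := u 0 * v 1 - u 1 * v 0

/-- The transposed incidence matrix of the oriented graph with head map `h` and tail map `t`. -/
noncomputable def Hmat {n m : ℕ} (h t : Fin m → Fin n) : Matrix (Fin m) (Fin n) ℝ :=
  fun k i => if i = h k then 1 else if i = t k then -1 else 0

/-- The edge vectors `z k = x (h k) − x (t k)` of a multi-point `x`. -/
noncomputable def edgeVec {n m : ℕ} (h t : Fin m → Fin n) (x : Fin n → Fin 2 → ℝ) :
    Fin m → Fin 2 → ℝ :=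
  fun k => x (h k) - x (t k)

/-- The rigidity matrix `R k (i, c) = H k i * (z k) c`. -/
noncomputable def rigidityMat {n m : ℕ} (h t : Fin m → Fin n) (x : Fin n → Fin 2 → ℝ) :
    Matrix (Fin m) (Fin n × Fin 2) ℝ :=
  fun k ic => Hmat h t k ic.1 * edgeVec h t x k ic.2

theorem rigidityMat_mulVec {n m : ℕ} (h t : Fin m → Fin n) (hht : ∀ k, h k ≠ t k)
    (x : Fin n → Fin 2 → ℝ) (w : Fin n × Fin 2 → ℝ) (k : Fin m) :
    (rigidityMat h t x).mulVec w k =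
      ∑ c, edgeVec h t x k c * (w (h k, c) - w (t k, c)) := by
  have hH : ∀ i, Hmat h t k i = (if i = h k then 1 else 0) - (if i = t k then 1 else 0) := by
    intro i
    unfold Hmat
    have := hht k
    split_ifs with h1 h2
    · exact absurd (h1.symm.trans h2) this
    all_goals simp
  simp only [Matrix.mulVec, dotProduct, rigidityMat, Fintype.sum_prod_type_right, hH]
  refine Finset.sum_congr rfl fun c _ => ?_
  simp [sub_mul, mul_sub, Finset.sum_sub_distrib]

/-- Some nonzero vector of the plane is orthogonal to all members of a pairwise parallel
family. -/
theorem exists_ne_zero_orthogonal {ι : Type*} (z : ι → Fin 2 → ℝ) (s : Set ι)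
    (hz : ∀ k ∈ s, ∀ l ∈ s, wedge (z k) (z l) = 0) :
    ∃ e : Fin 2 → ℝ, e ≠ 0 ∧ ∀ k ∈ s, ∑ c, z k c * e c = 0 := by
  by_cases H : ∃ k ∈ s, z k ≠ 0
  · obtain ⟨k, hk, hk0⟩ := H
    refine ⟨![-z k 1, z k 0], fun h0 => hk0 ?_, fun l hl => ?_⟩
    · have h1 := congrFun h0 0
      have h2 := congrFun h0 1
      ext c
      fin_cases c <;> simp_all
    · have := hz k hk l hl
      simp only [wedge] at this
      simp only [Fin.sum_univ_two, Matrix.cons_val_zero, Matrix.cons_val_one]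
      linarith
  · push Not at H
    refine ⟨![1, 0], fun h0 => by simpa using congrFun h0 0, fun l hl => by simp [H l hl]⟩

/-- Moving every vertex `i` along `e i` with its own speed, together with a common translation
along `d`. -/
def vertexMotion {n : ℕ} (e : Fin n → Fin 2 → ℝ) (d : Fin 2 → ℝ) :
    ((Fin n → ℝ) × ℝ) →ₗ[ℝ] (Fin n × Fin 2 → ℝ) where
  toFun a ic := a.1 ic.1 * e ic.1 ic.2 + a.2 * d ic.2
  map_add' a b := by ext; simp; ring
  map_smul' r a := by ext; simp; ring

theorem vertexMotion_injective {n : ℕ} {e : Fin n → Fin 2 → ℝ} {d : Fin 2 → ℝ}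
    (he : ∀ i, e i ≠ 0) (v : Fin n) (hd : wedge (e v) d ≠ 0) :
    Function.Injective (vertexMotion e d) := by
  rw [← LinearMap.ker_eq_bot, LinearMap.ker_eq_bot']
  rintro ⟨a, b⟩ hab
  have hc : ∀ i c, a i * e i c + b * d c = 0 := fun i c => congrFun hab (i, c)
  have hb : b = 0 := by
    refine (mul_eq_zero.mp ?_).resolve_right hd
    simp only [wedge]
    linear_combination e v 0 * hc v 1 - e v 1 * hc v 0
  have ha : a = 0 := by
    ext i
    obtain ⟨c, hic⟩ := Function.ne_iff.mp (he i)
    have := hc i c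
    simp only [hb, zero_mul, add_zero] at this
    exact (mul_eq_zero.mp this).resolve_right hic
  simp [ha, hb]

theorem rigidityMat_rank_lt {n m : ℕ} [NeZero n] (h t : Fin m → Fin n)
    (hht : ∀ k, h k ≠ t k) (x : Fin n → Fin 2 → ℝ) (e : Fin n → Fin 2 → ℝ) (he : ∀ i, e i ≠ 0)
    (horth : ∀ i k, i = h k ∨ i = t k → ∑ c, edgeVec h t x k c * e i c = 0) :
    (rigidityMat h t x).rank < n := by
  let d : Fin 2 → ℝ := ![-e 0 1, e 0 0]
  have hd : wedge (e 0) d ≠ 0 := by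
    intro h0
    simp only [wedge, d, Matrix.cons_val_zero, Matrix.cons_val_one] at h0
    refine he 0 (funext fun c => ?_)
    fin_cases c <;> simp <;> nlinarith [sq_nonneg (e 0 0), sq_nonneg (e 0 1)]
  have hle : LinearMap.range (vertexMotion e d) ≤
      LinearMap.ker (rigidityMat h t x).mulVecLin := by
    rintro _ ⟨a, rfl⟩
    ext k
    have hh := horth _ k (Or.inl rfl)
    have ht := horth _ k (Or.inr rfl)
    rw [Matrix.mulVecLin_apply, rigidityMat_mulVec h t hht]
    simp only [Fin.sum_univ_two, vertexMotion, LinearMap.coe_mk, AddHom.coe_mk,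
      Pi.zero_apply] at hh ht ⊢
    linear_combination a.1 (h k) * hh - a.1 (t k) * ht
  have hfin := Submodule.finrank_mono hle
  rw [LinearMap.finrank_range_of_inj (vertexMotion_injective he 0 hd)] at hfin
  have hrn := LinearMap.finrank_range_add_finrank_ker (rigidityMat h t x).mulVecLin
  simp only [Module.finrank_prod, Module.finrank_pi, Module.finrank_self, Fintype.card_prod,
    Fintype.card_fin] at hfin hrn
  rw [Matrix.rank]
  omega

/-- Lemma: in an infinitesimally rigid framework in `ℝ²` (with `n ≥ 3` and connected
underlying graph) there are two edges sharing a common vertex whose edge vectors are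
non-parallel. -/
theorem stmt2 (n m : ℕ) (hn : 3 ≤ n) (h t : Fin m → Fin n) (hht : ∀ k, h k ≠ t k)
    (hconn : (SimpleGraph.fromRel
        (fun i j => ∃ k, ({h k, t k} : Set (Fin n)) = {i, j})).Connected)
    (x : Fin n → Fin 2 → ℝ)
    (hrank : (rigidityMat h t x).rank = 2 * n - 3) :
    ∃ (k l : Fin m) (v p q : Fin n),
      ({h k, t k} : Set (Fin n)) = {v, p} ∧
      ({h l, t l} : Set (Fin n)) = {v, q} ∧
      wedge (x p - x v) (x q - x v) ≠ 0 := by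
  by_contra! hcon
  have : NeZero n := ⟨by omega⟩
  have hpar : ∀ i, ∀ k ∈ {k | i = h k ∨ i = t k}, ∀ l ∈ {k | i = h k ∨ i = t k},
      wedge (edgeVec h t x k) (edgeVec h t x l) = 0 := by
    have hend : ∀ i k, i = h k ∨ i = t k → ∃ p, ({h k, t k} : Set (Fin n)) = {i, p} ∧
        (edgeVec h t x k = x p - x i ∨ edgeVec h t x k = -(x p - x i)) := by
      rintro i k (rfl | rfl)
      · exact ⟨t k, rfl, Or.inr (by simp [edgeVec])⟩
      · exact ⟨h k, Set.pair_comm _ _, Or.inl rfl⟩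
    intro i k hk l hl
    obtain ⟨p, hp, hkp⟩ := hend i k hk
    obtain ⟨q, hq, hlq⟩ := hend i l hl
    have hw := hcon k l i p q hp hq
    simp only [wedge] at hw ⊢
    rcases hkp with hkp | hkp <;> rcases hlq with hlq | hlq <;> rw [hkp, hlq] <;>
      simp only [Pi.neg_apply, Pi.sub_apply] at hw ⊢ <;> linarith
  choose e he horth using fun i => exists_ne_zero_orthogonal (edgeVec h t x) _ (hpar i)
  have hlt := rigidityMat_rank_lt h t hht x e he horth
  omega
end

section
/- Let n ≥ 3, let an oriented graph with m edges on Fin n be given by head/tail maps h, t : Fin m → Fin n with h k ≠ t k, let x : Fin n → (Fin 2 → ℝ) be a multi-point, and let R be its rigidity matrix; assume rank R = 2n − 3. Define q₁, q₂, q₃ ∈ ℝ^(Fin n × Fin 2) by q₁(i,0) = 1, q₁(i,1) = 0; q₂(i,0) = 0, q₂(i,1) = 1; q₃(i,0) = −x i 1, q₃(i,1) = x i 0 (i.e. the i-th block of q₃ is the 90° rotation K(x i) with K = [[0,−1],[1,0]]); let v̄ = (1/n) Σᵢ x i and set q₀ = q₃ + (v̄ 1) • q₁ − (v̄ 0) •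 q₂. Then: (a) R *ᵥ q₀ = 0, R *ᵥ q₁ = 0 and R *ᵥ q₂ = 0; (b) q₀, q₁, q₂ are pairwise orthogonal and each is nonzero; (c) q₀, q₁, q₂ span the kernel of the linear map v ↦ R *ᵥ v, i.e. {q₀, q₁, q₂} is an orthogonal basis of ker R. -/
open Matrix

/-- `q₁ (i, 0) = 1`, `q₁ (i, 1) = 0`. -/
noncomputable def q1 (n : ℕ) : Fin n × Fin 2 → ℝ := fun ic => if ic.2 = 0 then 1 else 0

/-- `q₂ (i, 0) = 0`, `q₂ (i, 1) = 1`. -/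
noncomputable def q2 (n : ℕ) : Fin n × Fin 2 → ℝ := fun ic => if ic.2 = 0 then 0 else 1

/-- `q₃`'s `i`-th block is `K (x i)` with `K = [[0,−1],[1,0]]`. -/
noncomputable def q3 {n : ℕ} (x : Fin n → Fin 2 → ℝ) : Fin n × Fin 2 → ℝ :=
  fun ic => if ic.2 = 0 then -(x ic.1 1) else x ic.1 0

/-- The average `v̄ = (1/n) Σᵢ x i`. -/
noncomputable def vavg {n : ℕ} (x : Fin n → Fin 2 → ℝ) : Fin 2 → ℝ :=
  (n : ℝ)⁻¹ • ∑ i, x i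

/-- `q₀ = q₃ + (v̄ 1) • q₁ − (v̄ 0) • q₂`. -/
noncomputable def q0 {n : ℕ} (x : Fin n → Fin 2 → ℝ) : Fin n × Fin 2 → ℝ :=
  q3 x + vavg x 1 • q1 n - vavg x 0 • q2 n

theorem rigidityMat_mulVec_apply {n m : ℕ} {h t : Fin m → Fin n} (hht : ∀ k, h k ≠ t k)
    (x : Fin n → Fin 2 → ℝ) (v : Fin n × Fin 2 → ℝ) (k : Fin m) :
    (rigidityMat h t x *ᵥ v) k = ∑ c, edgeVec h t x k c * (v (h k, c) - v (t k, c)) := by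
  have hH : ∀ i, Hmat h t k i = (if i = h k then 1 else 0) - (if i = t k then 1 else 0) := by
    intro i
    have := hht k
    unfold Hmat
    split_ifs <;> grind
  simp only [Matrix.mulVec, dotProduct, rigidityMat, Fintype.sum_prod_type_right, hH]
  refine Finset.sum_congr rfl fun c _ => ?_
  simp [sub_mul, mul_sub, Finset.sum_sub_distrib]

theorem rigidityMat_mulVec_q1 {n m : ℕ} {h t : Fin m → Fin n} (hht : ∀ k, h k ≠ t k)
    (x : Fin n → Fin 2 → ℝ) : rigidityMat h t x *ᵥ q1 n = 0 := by
  ext k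
  simp [rigidityMat_mulVec_apply hht, q1]

theorem rigidityMat_mulVec_q2 {n m : ℕ} {h t : Fin m → Fin n} (hht : ∀ k, h k ≠ t k)
    (x : Fin n → Fin 2 → ℝ) : rigidityMat h t x *ᵥ q2 n = 0 := by
  ext k
  simp [rigidityMat_mulVec_apply hht, q2]

theorem rigidityMat_mulVec_q3 {n m : ℕ} {h t : Fin m → Fin n} (hht : ∀ k, h k ≠ t k)
    (x : Fin n → Fin 2 → ℝ) : rigidityMat h t x *ᵥ q3 x = 0 := by
  ext k
  simp [rigidityMat_mulVec_apply hht, q3, edgeVec]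
  ring

theorem rigidityMat_mulVec_q0 {n m : ℕ} {h t : Fin m → Fin n} (hht : ∀ k, h k ≠ t k)
    (x : Fin n → Fin 2 → ℝ) : rigidityMat h t x *ᵥ q0 x = 0 := by
  simp [q0, Matrix.mulVec_add, Matrix.mulVec_sub, Matrix.mulVec_smul,
    rigidityMat_mulVec_q1 hht, rigidityMat_mulVec_q2 hht, rigidityMat_mulVec_q3 hht]

theorem q0_apply_zero {n : ℕ} (x : Fin n → Fin 2 → ℝ) (i : Fin n) :
    q0 x (i, 0) = vavg x 1 - x i 1 := by
  simp [q0, q1, q2, q3]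
  ring

theorem q0_apply_one {n : ℕ} (x : Fin n → Fin 2 → ℝ) (i : Fin n) :
    q0 x (i, 1) = x i 0 - vavg x 0 := by
  simp [q0, q1, q2, q3]

theorem natCast_mul_vavg {n : ℕ} (hn : n ≠ 0) (x : Fin n → Fin 2 → ℝ) (c : Fin 2) :
    n * vavg x c = ∑ i, x i c := by
  simp [vavg, hn]

theorem q0_dotProduct_q1 {n : ℕ} (hn : n ≠ 0) (x : Fin n → Fin 2 → ℝ) :
    q0 x ⬝ᵥ q1 n = 0 := by
  simp [dotProduct, Fintype.sum_prod_type, q0_apply_zero, q1, natCast_mul_vavg hn]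

theorem q0_dotProduct_q2 {n : ℕ} (hn : n ≠ 0) (x : Fin n → Fin 2 → ℝ) :
    q0 x ⬝ᵥ q2 n = 0 := by
  simp [dotProduct, Fintype.sum_prod_type, q0_apply_one, q2, natCast_mul_vavg hn]

theorem q1_dotProduct_q2 (n : ℕ) : q1 n ⬝ᵥ q2 n = 0 := by
  simp [dotProduct, Fintype.sum_prod_type, q1, q2]

theorem q1_ne_zero {n : ℕ} (hn : n ≠ 0) : q1 n ≠ 0 := fun h0 => by
  simpa [q1] using congrFun h0 (⟨0, Nat.pos_of_ne_zero hn⟩, 0)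

theorem q2_ne_zero {n : ℕ} (hn : n ≠ 0) : q2 n ≠ 0 := fun h0 => by
  simpa [q2] using congrFun h0 (⟨0, Nat.pos_of_ne_zero hn⟩, 1)

theorem rigidityMat_eq_zero_of_q0_eq_zero {n m : ℕ} (h t : Fin m → Fin n)
    {x : Fin n → Fin 2 → ℝ} (h0 : q0 x = 0) : rigidityMat h t x = 0 := by
  have hx : ∀ i, x i = vavg x := by
    intro i
    have h1 := congrFun h0 (i, 0)
    have h2 := congrFun h0 (i, 1)
    rw [q0_apply_zero, Pi.zero_apply] at h1
    rw [q0_apply_one, Pi.zero_apply] at h2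
    ext c
    fin_cases c
    · exact sub_eq_zero.mp h2
    · exact (sub_eq_zero.mp h1).symm
  ext k p
  simp [rigidityMat, edgeVec, hx (h k), hx (t k)]

theorem linearIndependent_of_dotProduct_eq_zero {ι κ : Type*} [Fintype ι] [Fintype κ]
    {v : κ → ι → ℝ} (hne : ∀ i, v i ≠ 0) (ho : Pairwise fun i j => v i ⬝ᵥ v j = 0) :
    LinearIndependent ℝ v := by
  rw [Fintype.linearIndependent_iff]
  intro g hg i
  have hi : (∑ j, g j • v j) ⬝ᵥ v i = g i * (v i ⬝ᵥ v i) := by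
    rw [sum_dotProduct, Finset.sum_eq_single i]
    · rw [smul_dotProduct, smul_eq_mul]
    · intro j _ hj
      rw [smul_dotProduct, ho hj, smul_zero]
    · simp
  rw [hg, zero_dotProduct, eq_comm, mul_eq_zero, dotProduct_self_eq_zero] at hi
  exact hi.resolve_right (hne i)

/-- For an infinitesimally rigid framework, `{q₀, q₁, q₂}` is an orthogonal basis of
the kernel of the rigidity matrix `R`. -/
theorem stmt4 (n m : ℕ) (hn : 3 ≤ n) (h t : Fin m → Fin n) (hht : ∀ k, h k ≠ t k)
    (x : Fin n → Fin 2 → ℝ)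
    (hrank : (rigidityMat h t x).rank = 2 * n - 3) :
    -- (a) q₀, q₁, q₂ lie in the kernel of R
    (rigidityMat h t x *ᵥ q0 x = 0 ∧
     rigidityMat h t x *ᵥ q1 n = 0 ∧
     rigidityMat h t x *ᵥ q2 n = 0) ∧
    -- (b) they are pairwise orthogonal and nonzero
    ((∑ p, q0 x p * q1 n p = 0) ∧ (∑ p, q0 x p * q2 n p = 0) ∧
     (∑ p, q1 n p * q2 n p = 0) ∧ q0 x ≠ 0 ∧ q1 n ≠ 0 ∧ q2 n ≠ 0) ∧
    -- (c) they span the kernel of v ↦ R *ᵥ v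
    Submodule.span ℝ {q0 x, q1 n, q2 n} = LinearMap.ker (rigidityMat h t x).mulVecLin := by
  have hn0 : n ≠ 0 := by omega
  have hq0 : q0 x ≠ 0 := by
    intro h0
    rw [rigidityMat_eq_zero_of_q0_eq_zero h t h0, Matrix.rank_zero] at hrank
    omega
  have h01 := q0_dotProduct_q1 hn0 x
  have h02 := q0_dotProduct_q2 hn0 x
  have h12 := q1_dotProduct_q2 n
  refine ⟨⟨rigidityMat_mulVec_q0 hht x, rigidityMat_mulVec_q1 hht x, rigidityMat_mulVec_q2 hht x⟩,
    ⟨h01, h02, h12, hq0, q1_ne_zero hn0, q2_ne_zero hn0⟩, ?_⟩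
  have hli : LinearIndependent ℝ ![q0 x, q1 n, q2 n] := by
    apply linearIndependent_of_dotProduct_eq_zero
    · intro i
      fin_cases i
      exacts [hq0, q1_ne_zero hn0, q2_ne_zero hn0]
    · intro i j hij
      fin_cases i <;> fin_cases j <;>
        simp_all [dotProduct_comm (q1 n) (q0 x), dotProduct_comm (q2 n)]
  have hspan := finrank_span_eq_card hli
  rw [Matrix.range_cons, Matrix.range_cons_cons_empty, Set.singleton_union] at hspan
  apply Submodule.eq_of_le_of_finrank_eq
  · rw [Submodule.span_le]
    rintro v (rfl | rfl | rfl)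
    exacts [rigidityMat_mulVec_q0 hht x, rigidityMat_mulVec_q1 hht x, rigidityMat_mulVec_q2 hht x]
  · have hker := (rigidityMat h t x).mulVecLin.finrank_range_add_finrank_ker
    change (rigidityMat h t x).rank + _ = _ at hker
    simp only [Module.finrank_fintype_fun_eq_card, Fintype.card_prod, Fintype.card_fin] at hker hspan
    omega
end

section
/- Let H : Matrix (Fin m) (Fin n) ℝ be any matrix, let w ∈ ℝ² and c : Fin m → ℝ, and suppose the edge vectors z : Fin m → (Fin 2 → ℝ) satisfy z k = (c k) • w for every k. Then the matrix R : Matrix (Fin m) (Fin n × Fin 2) ℝ defined by R k (i, a) = H k i * (z k) a satisfies rank R ≤ rank H. (In particular, if H is the transposed incidence matrix of a connected graph on n vertices, so that rank H = n − 1 < 2n − 3 for n ≥ 3, then all edge vectors being parallel contradicts infinitesimal rigidity rank R = 2n − 3.) -/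
open Matrix

/-- If all edge vectors `z k` are scalar multiples of a common vector `w ∈ ℝ²`, then the
matrix `R k (i, a) = H k i * (z k) a` has rank at most the rank of `H`. -/
theorem stmt5 (m n : ℕ) (H : Matrix (Fin m) (Fin n) ℝ) (w : Fin 2 → ℝ) (c : Fin m → ℝ)
    (z : Fin m → Fin 2 → ℝ) (hz : ∀ k, z k = c k • w)
    (R : Matrix (Fin m) (Fin n × Fin 2) ℝ)
    (hR : ∀ (k : Fin m) (i : Fin n) (a : Fin 2), R k (i, a) = H k i * z k a) :
    R.rank ≤ H.rank := by
  let B : Matrix (Fin n) (Fin n × Fin 2) ℝ := of fun j p => if j = p.1 then w p.2 else 0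
  have h_factor : R = diagonal c * (H * B) := by
    ext k ⟨i, a⟩
    rw [diagonal_mul]
    simp only [hR, hz, mul_apply, B, of_apply, mul_ite, mul_zero,
      Finset.sum_ite_eq', Finset.mem_univ, if_true, Pi.smul_apply, smul_eq_mul]
    ring
  rw [h_factor]
  exact (rank_mul_le_right _ _).trans (rank_mul_le_left _ _)
end

section
/- Let Q : Matrix (Fin m) (Fin m) ℝ be a symmetric positive definite matrix and let F : Matrix (Fin p) (Fin m) ℝ be any real matrix. Then the matrix −2 • (Q * (1 + Fᵀ * F)) is a stability matrix: every eigenvalue λ ∈ ℂ of its complexification (the matrix obtained by mapping entries into ℂ) has negative real part. -/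
open Matrix

open scoped ComplexOrder MatrixOrder in
/-- A real positive definite matrix stays positive definite over `ℂ`. -/
theorem Matrix.PosDef.map_complex_algebraMap {n : Type*} [Fintype n] {A : Matrix n n ℝ}
    (hA : A.PosDef) : (A.map (algebraMap ℝ ℂ)).PosDef := by
  classical
  obtain ⟨B, hB⟩ := CStarAlgebra.nonneg_iff_eq_star_mul_self.mp hA.posSemidef.nonneg
  have hmap : A.map (algebraMap ℝ ℂ) =
      (B.map (algebraMap ℝ ℂ))ᴴ * B.map (algebraMap ℝ ℂ) := by
    rw [hB, Matrix.map_mul, star_eq_conjTranspose]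
    congr 1
    ext i j
    simp
  have hunit : IsUnit (A.map (algebraMap ℝ ℂ)) := hA.isUnit.map (algebraMap ℝ ℂ).mapMatrix
  have hsemi : (A.map (algebraMap ℝ ℂ)).PosSemidef :=
    hmap ▸ posSemidef_conjTranspose_mul_self _
  exact hsemi.posDef_iff_isUnit.mpr hunit

open scoped ComplexOrder in
/-- Every eigenvalue of a product of two positive definite matrices is positive. -/
theorem Matrix.PosDef.pos_of_mul_mulVec_eq_smul {n 𝕜 : Type*} [Fintype n] [RCLike 𝕜]
    {P S : Matrix n n 𝕜} (hP : P.PosDef) (hS : S.PosDef) {v : n → 𝕜} (hv : v ≠ 0) {c : 𝕜}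
    (h : (P * S) *ᵥ v = c • v) : 0 < c := by
  have hSv := hS.dotProduct_mulVec_pos hv
  have hw : S *ᵥ v ≠ 0 := fun h0 => by simp [h0] at hSv
  have hPw := hP.dotProduct_mulVec_pos hw
  rw [mulVec_mulVec, h, dotProduct_smul, star_mulVec, hS.isHermitian.eq, ← dotProduct_mulVec,
    smul_eq_mul] at hPw
  exact pos_of_mul_pos_left hPw hSv.le

/-- If `Q` is symmetric positive definite and `F` is arbitrary, then `−2 Q (I + Fᵀ F)` is a
stability matrix: every complex eigenvalue has negative real part. -/
theorem stmt6 (m p : ℕ) (Q : Matrix (Fin m) (Fin m) ℝ) (hQ : Q.PosDef)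
    (F : Matrix (Fin p) (Fin m) ℝ) :
    ∀ μ ∈ spectrum ℂ ((((-2 : ℝ) • (Q * (1 + Fᵀ * F))).map (algebraMap ℝ ℂ))),
      μ.re < 0 := by
  intro μ hμ
  have hS : (1 + Fᵀ * F).PosDef :=
    PosDef.one.add_posSemidef (by simpa using posSemidef_conjTranspose_mul_self F)
  rw [← spectrum_toLin', ← Module.End.hasEigenvalue_iff_mem_spectrum] at hμ
  obtain ⟨v, hv⟩ := hμ.exists_hasEigenvector
  have hmap : ((-2 : ℝ) • (Q * (1 + Fᵀ * F))).map (algebraMap ℝ ℂ) =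
      (-2 : ℂ) • (Q.map (algebraMap ℝ ℂ) * (1 + Fᵀ * F).map (algebraMap ℝ ℂ)) := by
    rw [← Matrix.map_mul]
    ext i j
    simp
  have hv' := hv.apply_eq_smul
  rw [hmap, toLin'_apply, smul_mulVec] at hv'
  have hc := hQ.map_complex_algebraMap.pos_of_mul_mulVec_eq_smul hS.map_complex_algebraMap hv.2
    (c := (-2 : ℂ)⁻¹ * μ) (by rw [mul_smul, ← hv', inv_smul_smul₀ (by norm_num)])
  have hre := (Complex.lt_def.mp hc).1
  rw [show ((-2 : ℂ)⁻¹) = ((-2⁻¹ : ℝ) : ℂ) by push_cast; norm_num, Complex.re_ofReal_mul,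
    Complex.zero_re] at hre
  linarith
end

section
/- Let ω > 0, let rᵢ > 0 and rⱼ > 0, let φᵢ, φⱼ ∈ ℝ, and let σᵢ, σⱼ ∈ {1, −1}. If the function t ↦ rᵢ·rⱼ·( cos(ωt + φᵢ)·cos(ωt + φⱼ) + σᵢ·σⱼ·sin(ωt + φᵢ)·sin(ωt + φⱼ) ) is constant on ℝ, then σᵢ = σⱼ. -/
/-- If the inner product `z̄ᵢ(t)ᵀ z̄ⱼ(t)` of the two rotating planar vectors is constant
in `t`, then the rotation senses agree: `σᵢ = σⱼ`. -/
theorem stmt9 (ω ri rj φi φj σi σj : ℝ) (hω : 0 < ω) (hri : 0 < ri) (hrj : 0 < rj)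
    (hσi : σi = 1 ∨ σi = -1) (hσj : σj = 1 ∨ σj = -1)
    (hconst : ∃ C : ℝ, ∀ t : ℝ,
      ri * rj * (Real.cos (ω * t + φi) * Real.cos (ω * t + φj) +
        σi * σj * (Real.sin (ω * t + φi) * Real.sin (ω * t + φj))) = C) :
    σi = σj := by
  obtain ⟨C, hC⟩ := hconst
  by_contra hne
  have hσ : σi * σj = -1 := by
    rcases hσi with rfl | rfl <;> rcases hσj with rfl | rfl <;> simp_all
  have hcos (s : ℝ) : ri * rj * Real.cos s = C := by
    rw [← hC ((s - φi - φj) / (2 * ω)), hσ, neg_one_mul, ← sub_eq_add_neg, ← Real.cos_add]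
    congr 2
    field_simp
    ring
  have h0 := hcos 0
  have hπ := hcos Real.pi
  rw [Real.cos_zero] at h0
  rw [Real.cos_pi] at hπ
  linarith [mul_pos hri hrj]
end

section
/- Let a > 0, b > 0, ω ≠ 0 and θ, γ ∈ ℝ. If the function t ↦ a²·(sin(ωt + θ))² + b²·(cos(ωt + γ))² is constant on ℝ, then a = b and there exists an integer k with γ = θ + k·π. -/
/-- If `t ↦ a²·sin²(ωt + θ) + b²·cos²(ωt + γ)` is constant (with `a, b > 0`, `ω ≠ 0`),
then `a = b` and `γ = θ + kπ` for some integer `k`. -/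
theorem stmt10 (a b ω θ γ : ℝ) (ha : 0 < a) (hb : 0 < b) (hω : ω ≠ 0)
    (hconst : ∃ C : ℝ, ∀ t : ℝ,
      a ^ 2 * (Real.sin (ω * t + θ)) ^ 2 + b ^ 2 * (Real.cos (ω * t + γ)) ^ 2 = C) :
    a = b ∧ ∃ k : ℤ, γ = θ + k * Real.pi := by
  obtain ⟨C, hC⟩ := hconst
  have key : ∀ s : ℝ, a ^ 2 * Real.sin s ^ 2 +
      b ^ 2 * (Real.cos s * Real.cos (γ - θ) - Real.sin s * Real.sin (γ - θ)) ^ 2 = C := by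
    intro s
    have h := hC ((s - θ) / ω)
    rw [mul_div_cancel₀ _ hω, sub_add_cancel, show s - θ + γ = s + (γ - θ) by ring,
      Real.cos_add] at h
    exact h
  have h_zero := key 0
  have h_half := key (Real.pi / 2)
  have h_quarter := key (Real.pi / 4)
  have h_neg_quarter := key (-(Real.pi / 4))
  have hpyth := Real.sin_sq_add_cos_sq (γ - θ)
  simp only [Real.sin_zero, Real.cos_zero, Real.sin_pi_div_two, Real.cos_pi_div_two,
    Real.sin_neg, Real.cos_neg, Real.sin_pi_div_four, Real.cos_pi_div_four]
    at h_zero h_half h_quarter h_neg_quarter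
  have hsqrt : √(2 : ℝ) ^ 2 = 2 := Real.sq_sqrt (by norm_num)
  have hprod : b ^ 2 * (Real.cos (γ - θ) * Real.sin (γ - θ)) = 0 := by
    linear_combination (h_neg_quarter - h_quarter) / 2 -
      b ^ 2 * Real.cos (γ - θ) * Real.sin (γ - θ) / 2 * hsqrt
  have hcos : Real.cos (γ - θ) ≠ 0 := by
    intro h
    rw [h] at h_zero h_half
    nlinarith [sq_nonneg (b * Real.sin (γ - θ)), pow_pos ha 2]
  have hsin : Real.sin (γ - θ) = 0 := by
    simpa [hb.ne', hcos] using hprod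
  rw [hsin] at h_zero h_half hpyth
  refine ⟨?_, ?_⟩
  · have hsq : a ^ 2 = b ^ 2 := by
      linear_combination h_half - h_zero + b ^ 2 * hpyth
    exact (sq_eq_sq₀ ha.le hb.le).mp hsq
  · obtain ⟨k, hk⟩ := Real.sin_eq_zero_iff.mp hsin
    exact ⟨k, by linarith⟩
end

section
/- Let n ≥ 3, let an oriented graph with m edges on Fin n be given by head/tail maps h, t : Fin m → Fin n with h k ≠ t k, fix target distances d : Fin m → ℝ and mismatch vector μ : Fin m → ℝ, and let x : ℝ → (Fin n → (Fin 2 → ℝ)) be a differentiable trajectory satisfying the overall system: for every i ∈ Fin n and time s, (d/ds) x(s) i = − Σ_{k : h k = i} e_k(s) • z_k(s) + Σ_{k : t k = i} (e_k(s) + μ k) • z_k(s), where z_k(s) = x(s)(h k) − x(s)(t k) and e_k(s) = ‖z_k(s)‖² − (d k)². Then for every k ∈ Fin m, the function s ↦ e_k(s) is differentiable with derivative (d/ds) e_k(s) = −2·Σ_l (R(s) * R(s)ᵀ) k l · e_l(s) + 2·Σ_l (R(s) * S(s)ᵀ) k l · μ l, where R(s) and S(s) are the matrices of the framework setup evaluated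 at x(s). -/
open Matrix

/-- The matrix `S k (i, c) = (if i = t k then 1 else 0) * (z k) c`. -/
noncomputable def Smat {n m : ℕ} (h t : Fin m → Fin n) (x : Fin n → Fin 2 → ℝ) :
    Matrix (Fin m) (Fin n × Fin 2) ℝ :=
  fun k ic => (if ic.1 = t k then 1 else 0) * edgeVec h t x k ic.2

/-- The rigidity matrix acts on a velocity field by pairing each edge vector with the relative
velocity of its endpoints. -/
theorem sum_rigidityMat_mul {n m : ℕ} (h t : Fin m → Fin n) (hht : ∀ k, h k ≠ t k)
    (x : Fin n → Fin 2 → ℝ) (v : Fin n × Fin 2 → ℝ) (k : Fin m) :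
    ∑ ic, rigidityMat h t x k ic * v ic
      = ∑ c, edgeVec h t x k c * (v (h k, c) - v (t k, c)) := by
  rw [Fintype.sum_prod_type_right]
  refine Finset.sum_congr rfl fun c _ => ?_
  have hsplit : ∀ i, rigidityMat h t x k (i, c) * v (i, c)
      = (if i = h k then edgeVec h t x k c * v (i, c) else 0)
        - (if i = t k then edgeVec h t x k c * v (i, c) else 0) := by
    intro i
    have hk := hht k
    simp only [rigidityMat, Hmat]
    split_ifs with h₁ h₂
    · exact absurd (h₁.symm.trans h₂) hk
    all_goals ring
  simp [hsplit, mul_sub]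

/-- The vertex velocities of the overall system in matrix form, `ẋ = −Rᵀe + Sᵀμ`. -/
theorem velocity_eq_sum_rigidityMat {n m : ℕ} (h t : Fin m → Fin n) (hht : ∀ k, h k ≠ t k)
    (x : Fin n → Fin 2 → ℝ) (e μ : Fin m → ℝ) (i : Fin n) (c : Fin 2) :
    (-∑ k ∈ Finset.univ.filter (fun k => h k = i), e k * edgeVec h t x k c)
        + ∑ k ∈ Finset.univ.filter (fun k => t k = i), (e k + μ k) * edgeVec h t x k c
      = ∑ l, (-(rigidityMat h t x l (i, c) * e l) + Smat h t x l (i, c) * μ l) := by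
  rw [Finset.sum_filter, Finset.sum_filter, ← Finset.sum_neg_distrib, ← Finset.sum_add_distrib]
  refine Finset.sum_congr rfl fun l _ => ?_
  have hl := hht l
  simp only [rigidityMat, Smat, Hmat, eq_comm (a := i)]
  split_ifs with h₁ h₂
  · exact absurd (h₁.trans h₂.symm) hl
  all_goals ring

/-- Along trajectories of the overall system `ẋ = −Rᵀe + Sᵀμ`, the error vector satisfies
`ė = −2 R Rᵀ e + 2 R Sᵀ μ`. -/
theorem stmt13 (n m : ℕ) (hn : 3 ≤ n) (h t : Fin m → Fin n) (hht : ∀ k, h k ≠ t k)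
    (d μ : Fin m → ℝ) (x : ℝ → Fin n → Fin 2 → ℝ)
    (z : ℝ → Fin m → Fin 2 → ℝ) (hz : ∀ (s : ℝ) (k : Fin m), z s k = x s (h k) - x s (t k))
    (e : ℝ → Fin m → ℝ)
    (he : ∀ (s : ℝ) (k : Fin m), e s k = (∑ c, (z s k c) ^ 2) - (d k) ^ 2)
    (hx : ∀ (i : Fin n) (s : ℝ) (c : Fin 2),
      HasDerivAt (fun u => x u i c)
        ((- ∑ k ∈ Finset.univ.filter (fun k => h k = i), e s k * z s k c)
          + ∑ k ∈ Finset.univ.filter (fun k => t k = i), (e s k + μ k) * z s k c) s) :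
    ∀ (k : Fin m) (s : ℝ),
      HasDerivAt (fun u => e u k)
        (-2 * ∑ l, (rigidityMat h t (x s) * (rigidityMat h t (x s))ᵀ) k l * e s l
          + 2 * ∑ l, (rigidityMat h t (x s) * (Smat h t (x s))ᵀ) k l * μ l) s := by
  intro k s
  obtain rfl : z = fun s => edgeVec h t (x s) := funext₂ hz
  have hder := ((HasDerivAt.fun_sum (u := Finset.univ) fun c _ =>
    ((hx (h k) s c).sub (hx (t k) s c)).pow 2).sub_const (d k ^ 2))
  simp only [velocity_eq_sum_rigidityMat h t hht] at hder
  have hfun : (fun u => e u k)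
      = fun u => (∑ c, (x u (h k) c - x u (t k) c) ^ 2) - d k ^ 2 := by
    funext u
    exact he u k
  rw [hfun]
  refine hder.congr_deriv ?_
  let v : Fin n × Fin 2 → ℝ := fun ic =>
    ∑ l, (-(rigidityMat h t (x s) l ic * e s l) + Smat h t (x s) l ic * μ l)
  have hleft : 2 * ∑ ic, rigidityMat h t (x s) k ic * v ic
      = -2 * ∑ l, (rigidityMat h t (x s) * (rigidityMat h t (x s))ᵀ) k l * e s l
          + 2 * ∑ l, (rigidityMat h t (x s) * (Smat h t (x s))ᵀ) k l * μ l := by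
    simp only [v, Matrix.mul_apply, Matrix.transpose_apply, Finset.mul_sum, Finset.sum_mul]
    rw [Finset.sum_comm, ← Finset.sum_add_distrib]
    refine Finset.sum_congr rfl fun l _ => ?_
    rw [← Finset.sum_add_distrib]
    exact Finset.sum_congr rfl fun ic _ => by ring
  rw [← hleft, sum_rigidityMat_mul h t hht, Finset.mul_sum]
  refine Finset.sum_congr rfl fun c _ => ?_
  simp only [v, edgeVec, Pi.sub_apply]
  norm_num
  ring
end

section
/- Let n be a positive integer. The set of multi-points x : Fin n → (Fin 2 → ℝ) that are unaligned — meaning that for all indices i, j, k, l ∈ Fin n with i ≠ j, k ≠ l and {i, j} ≠ {k, l} (as unordered pairs) one has (x i − x j) ∧ (x k − x l) ≠ 0 — is open and dense in the space (Fin n → (Fin 2 → ℝ)) of all multi-points. -/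
/-- A multi-point is unaligned if no two distinct segments determined by its points
are parallel. -/
def Unaligned {n : ℕ} (x : Fin n → Fin 2 → ℝ) : Prop :=
  ∀ i j k l : Fin n, i ≠ j → k ≠ l → ({i, j} : Set (Fin n)) ≠ {k, l} →
    wedge (x i - x j) (x k - x l) ≠ 0

theorem wedge_sub_sub_eq {n : ℕ} (i j k l : Fin n) :
    (fun x : Fin n → Fin 2 → ℝ => wedge (x i - x j) (x k - x l)) =
      fun x => (x i 0 - x j 0) * (x k 1 - x l 1) - (x i 1 - x j 1) * (x k 0 - x l 0) :=
  rfl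

theorem isOpen_wedge_ne_zero {n : ℕ} (i j k l : Fin n) :
    IsOpen {x : Fin n → Fin 2 → ℝ | wedge (x i - x j) (x k - x l) ≠ 0} := by
  refine isOpen_ne_fun ?_ continuous_const
  rw [wedge_sub_sub_eq]
  fun_prop

theorem analyticOnNhd_wedge {n : ℕ} (i j k l : Fin n) :
    AnalyticOnNhd ℝ (fun x : Fin n → Fin 2 → ℝ => wedge (x i - x j) (x k - x l))
      Set.univ := by
  intro x _
  have coord (m : Fin n) (c : Fin 2) :
      AnalyticAt ℝ (fun x : Fin n → Fin 2 → ℝ => x m c) x :=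
    ((ContinuousLinearMap.proj (R := ℝ) (φ := fun _ : Fin 2 => ℝ) c).comp
      (ContinuousLinearMap.proj (R := ℝ) (φ := fun _ : Fin n => Fin 2 → ℝ) m)).analyticAt x
  rw [wedge_sub_sub_eq]
  exact (((coord i 0).sub (coord j 0)).mul ((coord k 1).sub (coord l 1))).sub
    (((coord i 1).sub (coord j 1)).mul ((coord k 0).sub (coord l 0)))

theorem two_pow_add_two_pow_ne {n : ℕ} {i j k l : Fin n} (hij : i ≠ j) (hkl : k ≠ l)
    (h : ({i, j} : Set (Fin n)) ≠ {k, l}) :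
    2 ^ (i : ℕ) + 2 ^ (j : ℕ) ≠ 2 ^ (k : ℕ) + 2 ^ (l : ℕ) := by
  intro he
  have hs : ({(i : ℕ), (j : ℕ)} : Finset ℕ) = {(k : ℕ), (l : ℕ)} := by
    apply Finset.geomSum_injective (le_refl 2)
    simpa [Finset.sum_pair (Fin.val_ne_of_ne hij), Finset.sum_pair (Fin.val_ne_of_ne hkl)]
      using he
  apply h
  ext m
  simpa [Fin.ext_iff] using Finset.ext_iff.mp hs m

/-- The points `(2 ^ m, 4 ^ m)` of the parabola `y = x ^ 2` form an unaligned multi-point. -/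
theorem unaligned_parabola (n : ℕ) :
    Unaligned (fun m : Fin n => ![(2 : ℝ) ^ (m : ℕ), ((2 : ℝ) ^ (m : ℕ)) ^ 2]) := by
  intro i j k l hij hkl h
  have two_pow_sub_ne {a b : Fin n} (hab : a ≠ b) :
      (2 : ℝ) ^ (a : ℕ) - 2 ^ (b : ℕ) ≠ 0 := fun h0 =>
    hab (Fin.ext (pow_right_injective₀ (by norm_num) (by norm_num) (sub_eq_zero.mp h0)))
  have hsum : (2 : ℝ) ^ (k : ℕ) + 2 ^ (l : ℕ) - (2 ^ (i : ℕ) + 2 ^ (j : ℕ)) ≠ 0 := fun h0 =>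
    two_pow_add_two_pow_ne hij hkl h (by exact_mod_cast (sub_eq_zero.mp h0).symm)
  convert mul_ne_zero (mul_ne_zero (two_pow_sub_ne hij) (two_pow_sub_ne hkl)) hsum using 1
  simp only [wedge, Pi.sub_apply, Matrix.cons_val_zero, Matrix.cons_val_one]
  ring

theorem dense_wedge_ne_zero {n : ℕ} {i j k l : Fin n} (hij : i ≠ j) (hkl : k ≠ l)
    (h : ({i, j} : Set (Fin n)) ≠ {k, l}) :
    Dense {x : Fin n → Fin 2 → ℝ | wedge (x i - x j) (x k - x l) ≠ 0} := by
  intro x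
  by_contra hx
  have hzero : (fun x : Fin n → Fin 2 → ℝ => wedge (x i - x j) (x k - x l)) =ᶠ[nhds x] 0 := by
    filter_upwards [isClosed_closure.isOpen_compl.mem_nhds hx] with y hy
    by_contra hne
    exact hy (subset_closure hne)
  have hall := (analyticOnNhd_wedge i j k l).eqOn_zero_of_preconnected_of_eventuallyEq_zero
    isPreconnected_univ (Set.mem_univ x) hzero
  exact unaligned_parabola n i j k l hij hkl h
    (hall (x := fun m : Fin n => ![(2 : ℝ) ^ (m : ℕ), ((2 : ℝ) ^ (m : ℕ)) ^ 2]) trivial)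

/-- The set of unaligned multi-points is open and dense in the space of all multi-points. -/
theorem stmt14 (n : ℕ) (hn : 0 < n) :
    IsOpen {x : Fin n → Fin 2 → ℝ | Unaligned x} ∧
    Dense {x : Fin n → Fin 2 → ℝ | Unaligned x} := by
  simp only [Unaligned, Set.ofPred_forall]
  constructor
  · iterate 7 refine isOpen_iInter_of_finite fun _ => ?_
    exact isOpen_wedge_ne_zero _ _ _ _
  · iterate 7
      refine dense_iInter_of_isOpen (fun _ => ?_) fun _ => ?_
      · repeat refine isOpen_iInter_of_finite fun _ => ?_
        exact isOpen_wedge_ne_zero _ _ _ _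
    exact dense_wedge_ne_zero ‹_› ‹_› ‹_›
end

section
/- Let n ≥ 3 and let 𝒳 = { x : Fin n → (Fin 2 → ℝ) | x 0 ≠ x 1 } (multi-points with first two points distinct). For a nonzero q ∈ ℝ², let T_q ∈ M₂(ℝ) be the rotation matrix T_q = (1/‖q‖)·[[q 1, −q 0], [q 0, q 1]]. Define π : 𝒳 → ℝ × (Fin (n − 2) → (Fin 2 → ℝ)) by π(x) = ( ‖x 1 − x 0‖, fun j ↦ T_{(x 1 − x 0)} applied to (x (j+2) − x 0) ). Then π is smooth (infinitely differentiable) on the open set 𝒳, and at every x ∈ 𝒳 its Fréchet derivative is surjective; equivalently, the (2n−3) × 2n Jacobian matrix ∂π/∂x has full row rank 2n − 3 at every x ∈ 𝒳. -/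
/-- The rotation matrix `T_q = (1/‖q‖)[[q₁, −q₀], [q₀, q₁]]` applied to a vector `v`. -/
noncomputable def Tapply (q v : EuclideanSpace ℝ (Fin 2)) : EuclideanSpace ℝ (Fin 2) :=
  ‖q‖⁻¹ • (WithLp.equiv 2 (Fin 2 → ℝ)).symm
    ![q 1 * v 0 - q 0 * v 1, q 0 * v 0 + q 1 * v 1]

/-- The map `π(x) = (‖x₁ − x₀‖, (T_{x₁ − x₀}(x_{j+2} − x₀))_{j})` recording a formation
up to translation and rotation. -/
noncomputable def piMap (n : ℕ) (hn : 3 ≤ n) (x : Fin n → EuclideanSpace ℝ (Fin 2)) :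
    ℝ × (Fin (n - 2) → EuclideanSpace ℝ (Fin 2)) :=
  (‖x ⟨1, by omega⟩ - x ⟨0, by omega⟩‖,
   fun j => Tapply (x ⟨1, by omega⟩ - x ⟨0, by omega⟩)
     (x ⟨j.1 + 2, by have := j.2; omega⟩ - x ⟨0, by omega⟩))

/-- `Tapply` is smooth in both arguments as long as the rotating vector does not vanish. -/
lemma ContDiffAt.tapply {E : Type*} [NormedAddCommGroup E] [NormedSpace ℝ E] {k : WithTop ℕ∞}
    {q v : E → EuclideanSpace ℝ (Fin 2)} {x : E} (hq : ContDiffAt ℝ k q x)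
    (hv : ContDiffAt ℝ k v x) (hx : q x ≠ 0) :
    ContDiffAt ℝ k (fun y => Tapply (q y) (v y)) x := by
  have hq' := contDiffAt_euclidean.1 hq
  have hv' := contDiffAt_euclidean.1 hv
  refine ((hq.norm ℝ hx).inv (norm_ne_zero_iff.2 hx)).smul (contDiffAt_euclidean.2 fun i => ?_)
  fin_cases i
  · exact ((hq' 1).mul (hv' 0)).sub ((hq' 0).mul (hv' 1))
  · exact ((hq' 0).mul (hv' 0)).add ((hq' 1).mul (hv' 1))

/-- `Tapply q` only depends on the direction of `q`. -/
lemma Tapply_pos_smul_left {c : ℝ} (hc : 0 < c) (q v : EuclideanSpace ℝ (Fin 2)) :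
    Tapply (c • q) v = Tapply q v := by
  ext i
  fin_cases i <;> simp [Tapply, norm_smul, abs_of_pos hc] <;> field_simp

lemma Tapply_add_smul_right (q v w : EuclideanSpace ℝ (Fin 2)) (t : ℝ) :
    Tapply q (v + t • w) = Tapply q v + t • Tapply q w := by
  ext i
  fin_cases i <;> simp [Tapply] <;> ring

lemma Tapply_surjective {q : EuclideanSpace ℝ (Fin 2)} (hq : q ≠ 0) :
    Function.Surjective (Tapply q) := by
  intro w
  have hn : ‖q‖ ≠ 0 := norm_ne_zero_iff.2 hq
  have hsq : q 0 ^ 2 + q 1 ^ 2 = ‖q‖ ^ 2 := by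
    simp [EuclideanSpace.norm_sq_eq, Fin.sum_univ_two]
  refine ⟨‖q‖⁻¹ • !₂[q 1 * w 0 + q 0 * w 1, q 1 * w 1 - q 0 * w 0], ?_⟩
  ext i
  fin_cases i <;> simp [Tapply] <;> field_simp
  · linear_combination w 0 * hsq
  · linear_combination w 1 * hsq

lemma contDiffAt_piMap (n : ℕ) (hn : 3 ≤ n) {k : WithTop ℕ∞}
    {x : Fin n → EuclideanSpace ℝ (Fin 2)} (hx : x ⟨0, by omega⟩ ≠ x ⟨1, by omega⟩) :
    ContDiffAt ℝ k (piMap n hn) x := by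
  have hsub (i j : Fin n) :
      ContDiffAt ℝ k (fun y : Fin n → EuclideanSpace ℝ (Fin 2) => y i - y j) x :=
    (contDiffAt_pi.1 contDiffAt_id i).sub (contDiffAt_pi.1 contDiffAt_id j)
  have hq := sub_ne_zero.2 hx.symm
  exact ((hsub _ _).norm ℝ hq).prodMk
    (contDiffAt_pi.2 fun j => (hsub _ _).tapply (hsub _ _) hq)

/-- Every direction in the codomain is reached by moving the formation along a straight line
which fixes the first point and keeps the second one on the ray from the first. -/
lemma exists_piMap_add_smul (n : ℕ) (hn : 3 ≤ n) {x : Fin n → EuclideanSpace ℝ (Fin 2)}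
    (hx : x ⟨0, by omega⟩ ≠ x ⟨1, by omega⟩)
    (v : ℝ × (Fin (n - 2) → EuclideanSpace ℝ (Fin 2))) :
    ∃ d : Fin n → EuclideanSpace ℝ (Fin 2),
      ∀ᶠ t : ℝ in nhds 0, piMap n hn (x + t • d) = piMap n hn x + t • v := by
  obtain ⟨a, b⟩ := v
  set q := x ⟨1, by omega⟩ - x ⟨0, by omega⟩ with hqdef
  have hq : q ≠ 0 := sub_ne_zero.2 hx.symm
  have hn0 : ‖q‖ ≠ 0 := norm_ne_zero_iff.2 hq
  choose w hw using fun j => Tapply_surjective hq (b j)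
  let d : Fin n → EuclideanSpace ℝ (Fin 2) := fun i =>
    if i.1 = 0 then 0 else if i.1 = 1 then (a / ‖q‖) • q else
      if h : i.1 - 2 < n - 2 then w ⟨i.1 - 2, h⟩ else 0
  have hd0 : d ⟨0, by omega⟩ = 0 := by simp [d]
  have hd1 : d ⟨1, by omega⟩ = (a / ‖q‖) • q := by simp [d]
  have hd2 (j : Fin (n - 2)) : d ⟨j.1 + 2, by have := j.2; omega⟩ = w j := by simp [d]
  have hpos : ∀ᶠ t : ℝ in nhds 0, 0 < 1 + t * (a / ‖q‖) :=
    ContinuousAt.eventually_lt (f := fun _ => (0 : ℝ)) (by fun_prop) (by fun_prop) (by simp)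
  refine ⟨d, hpos.mono fun t ht => ?_⟩
  have h1 : (x + t • d) ⟨1, by omega⟩ - (x + t • d) ⟨0, by omega⟩ =
      (1 + t * (a / ‖q‖)) • q := by
    simp only [Pi.add_apply, Pi.smul_apply, hd0, hd1, smul_zero, add_zero, add_smul, one_smul,
      mul_smul]
    rw [hqdef]
    abel
  have h2 (j : Fin (n - 2)) :
      (x + t • d) ⟨j.1 + 2, by have := j.2; omega⟩ - (x + t • d) ⟨0, by omega⟩ =
        (x ⟨j.1 + 2, by have := j.2; omega⟩ - x ⟨0, by omega⟩) + t • w j := by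
    simp only [Pi.add_apply, Pi.smul_apply, hd0, hd2, smul_zero, add_zero]
    abel
  refine Prod.ext ?_ (funext fun j => ?_)
  · simp only [piMap, h1, Prod.fst_add, Prod.smul_fst, norm_smul, Real.norm_of_nonneg ht.le,
      ← hqdef, smul_eq_mul]
    field_simp
  · simp only [piMap, h1, h2, Tapply_pos_smul_left ht, Tapply_add_smul_right, hw]
    rfl

/-- On the open set `𝒳` of multi-points with `x 0 ≠ x 1`, the map `π` is smooth and its
Fréchet derivative is surjective at every point (full row rank `2n − 3`). -/
theorem stmt17 (n : ℕ) (hn : 3 ≤ n) :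
    ContDiffOn ℝ (⊤ : ℕ∞) (piMap n hn)
      {x : Fin n → EuclideanSpace ℝ (Fin 2) | x ⟨0, by omega⟩ ≠ x ⟨1, by omega⟩} ∧
    ∀ x ∈ {x : Fin n → EuclideanSpace ℝ (Fin 2) | x ⟨0, by omega⟩ ≠ x ⟨1, by omega⟩},
      Function.Surjective (fderiv ℝ (piMap n hn) x) := by
  refine ⟨fun x hx => (contDiffAt_piMap n hn hx).contDiffWithinAt, fun x hx v => ?_⟩
  obtain ⟨d, hd⟩ := exists_piMap_add_smul n hn hx v
  refine ⟨d, ?_⟩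
  have hdiff : DifferentiableAt ℝ (piMap n hn) x :=
    (contDiffAt_piMap n hn (k := 1) hx).differentiableAt one_ne_zero
  have hline : HasDerivAt (fun t : ℝ => piMap n hn (x + t • d)) (fderiv ℝ (piMap n hn) x d) 0 :=
    hdiff.hasFDerivAt.hasLineDerivAt d
  have haff : HasDerivAt (fun t : ℝ => piMap n hn x + t • v) v 0 := by
    simpa using ((hasDerivAt_id (0 : ℝ)).smul_const v).const_add (piMap n hn x)
  exact hline.unique (haff.congr_of_eventuallyEq hd)
end
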